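/- (Proposition 5.1, comparison of the τ, τ1 and π inclusion sets for the Jordan block) For every integer N > 1, every n ∈ {1, …, N−1}, every ε ≥ 0 and every t ∈ 𝕋: Γ^n_ε(V_N) = Spec_{ε+ε''_n} V_n, and Σ^n_ε(V_N) ⊊ Γ^n_ε(V_N) ⊊ Π^{n,t}_ε(V_N) ⊆ (1 + ε + ε'_n)·𝔻̄, where all three inclusions except the last are strict. -/

import Mathlib

open scoped Real

noncomputable section

namespace SpecInclJL

/-- The smallest singular value of a (possibly rectangular) complex matrix,
as the infimum of `‖F x‖` over the unit sphere. -/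
noncomputable def sval {ι κ : Type*} [Fintype ι] [Fintype κ] [DecidableEq κ]
    (F : Matrix ι κ ℂ) : ℝ :=
  sInf {y : ℝ | ∃ x : EuclideanSpace ℂ κ, ‖x‖ = 1 ∧ y = ‖Matrix.toEuclideanLin F x‖}

/-- The closed ε-pseudospectrum of a square complex matrix. -/
noncomputable def pspec {ι : Type*} [Fintype ι] [DecidableEq ι] (ε : ℝ)
    (E : Matrix ι ι ℂ) : Set ℂ :=
  {z : ℂ | sval (E - z • (1 : Matrix ι ι ℂ)) ≤ ε}

/-- The n×n Jordan block `V_n` (zero diagonal, ones on the superdiagonal). -/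
def Vm (n : ℕ) : Matrix (Fin n) (Fin n) ℂ :=
  fun i j => if (i : ℕ) + 1 = (j : ℕ) then 1 else 0

/-- The periodised Jordan block `V^{per,t}_n`: `V_n` plus the entry `t̄` in
position (n,1) (1-based); `V^{per,t}_1 = t̄`. -/
def Vper (n : ℕ) (t : ℂ) : Matrix (Fin n) (Fin n) ℂ :=
  fun i j => (if (i : ℕ) + 1 = (j : ℕ) then 1 else 0)
    + (if (i : ℕ) = n - 1 ∧ (j : ℕ) = 0 then (starRingEnd ℂ) t else 0)

/-- The (n+2)×n matrix `V⁺_n`: first row `(1,0,…,0)`, middle n rows `V_n`,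
last row zero. -/
def VP (n : ℕ) : Matrix (Fin (n + 2)) (Fin n) ℂ :=
  fun i j => if ((i : ℕ) = 0 ∧ (j : ℕ) = 0) ∨
    (1 ≤ (i : ℕ) ∧ (i : ℕ) ≤ n ∧ (j : ℕ) = (i : ℕ)) then 1 else 0

/-- The (n+2)×n matrix `Ṽ⁺_n`: zero first and last rows, middle part `V_n`. -/
def VtP (n : ℕ) : Matrix (Fin (n + 2)) (Fin n) ℂ :=
  fun i j => if 1 ≤ (i : ℕ) ∧ (i : ℕ) ≤ n ∧ (j : ℕ) = (i : ℕ) then 1 else 0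

/-- The (n+2)×n matrix `I⁺_n`: middle part the identity, first and last rows
zero. -/
def IP (n : ℕ) : Matrix (Fin (n + 2)) (Fin n) ℂ :=
  fun i j => if (i : ℕ) = (j : ℕ) + 1 then 1 else 0

/-- The closed ε-pseudospectrum of an (n+2)×n matrix `E⁺`:
`{λ : s_min(E⁺ − λ I⁺_n) ≤ ε}`. -/
noncomputable def pspecR {n : ℕ} (ε : ℝ) (E : Matrix (Fin (n + 2)) (Fin n) ℂ) :
    Set ℂ :=
  {z : ℂ | sval (E - z • IP n) ≤ ε}

/-- ε_n := 2 sin(π/(4n+2)). -/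
noncomputable def epsV (n : ℕ) : ℝ := 2 * Real.sin (Real.pi / (4 * (n : ℝ) + 2))

/-- ε'_n := 2 sin(π/(2n)). -/
noncomputable def epsV' (n : ℕ) : ℝ := 2 * Real.sin (Real.pi / (2 * (n : ℝ)))

/-- ε''_n := 2 sin(π/(2n+2)). -/
noncomputable def epsV'' (n : ℕ) : ℝ := 2 * Real.sin (Real.pi / (2 * (n : ℝ) + 2))

/-- The τ-method inclusion set `Σ^n_ε(V_N)` (independent of `N ≥ n+1`). -/
noncomputable def SigmaV (n : ℕ) (ε : ℝ) : Set ℂ :=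
  if n ≤ 2 then ⋃ m : Fin n, pspec (ε + epsV n) (Vm (m + 1))
  else pspec (ε + epsV (n - 2)) (Vm n) ∩ ⋃ m : Fin n, pspec (ε + epsV n) (Vm (m + 1))

/-- The π-method inclusion set `Π^{n,t}_ε(V_N)`. -/
noncomputable def PiV (n : ℕ) (t : ℂ) (ε : ℝ) : Set ℂ :=
  pspec (ε + epsV' n) (Vm n) ∪ pspec (ε + epsV' n) (Vper n t)

/-- The τ₁-method inclusion set `Γ^n_ε(V_N)`. -/
noncomputable def GammaV (n : ℕ) (ε : ℝ) : Set ℂ :=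
  pspecR (ε + epsV'' n) (VP n) ∪ pspecR (ε + epsV'' n) (VtP n)

/-- The closed disc of radius `r` centred at the origin. -/
def cDisc (r : ℝ) : Set ℂ := {z : ℂ | ‖z‖ ≤ r}

/-- The n×n discrete Laplacian `L_n` (zero diagonal, ones on the first sub-
and superdiagonals). -/
def Lm (n : ℕ) : Matrix (Fin n) (Fin n) ℂ :=
  fun i j => if (i : ℕ) + 1 = (j : ℕ) ∨ (j : ℕ) + 1 = (i : ℕ) then 1 else 0

/-- θ_n for the discrete Laplacian: the unique solution of
`8 sin(t/2) cos((n+1/2)t) + sin((n−1)t) = 0` in `[π/(2n+1), π/(n+2)]`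
(by uniqueness, the infimum of the solution set). -/
noncomputable def thetaL (n : ℕ) : ℝ :=
  sInf {t : ℝ | t ∈ Set.Icc (Real.pi / (2 * (n : ℝ) + 1)) (Real.pi / ((n : ℝ) + 2)) ∧
    8 * Real.sin (t / 2) * Real.cos (((n : ℝ) + 1 / 2) * t)
      + Real.sin (((n : ℝ) - 1) * t) = 0}

/-- ε_n := 4 sin(θ_n/2) for the discrete Laplacian. -/
noncomputable def epsL (n : ℕ) : ℝ := 4 * Real.sin (thetaL n / 2)

/-- ε''_n := 4 sin(π/(2n+2)) for the discrete Laplacian. -/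
noncomputable def epsL'' (n : ℕ) : ℝ := 4 * Real.sin (Real.pi / (2 * (n : ℝ) + 2))

/-- The τ-method inclusion set `Σ^n_ε(L_N)` (independent of `N ≥ n+1`). -/
noncomputable def SigmaL (n : ℕ) (ε : ℝ) : Set ℂ :=
  if n ≤ 2 then ⋃ m : Fin n, pspec (ε + epsL n) (Lm (m + 1))
  else pspec (ε + epsL (n - 2)) (Lm n) ∩ ⋃ m : Fin n, pspec (ε + epsL n) (Lm (m + 1))

/-- The (n+2)×n matrix `L⁺_n`: first row `(1,0,…,0)`, middle n rows `L_n`,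
last row `(0,…,0,1)`. -/
def LP (n : ℕ) : Matrix (Fin (n + 2)) (Fin n) ℂ :=
  fun i j => if ((i : ℕ) = 0 ∧ (j : ℕ) = 0) ∨
      (1 ≤ (i : ℕ) ∧ (i : ℕ) ≤ n ∧ ((j : ℤ) = (i : ℤ) - 2 ∨ (j : ℤ) = (i : ℤ))) ∨
      ((i : ℕ) = n + 1 ∧ (j : ℕ) + 1 = n) then 1 else 0

/-- The (n+2)×n matrix `L̃⁺_n`: first row `(1,0,…,0)`, middle n rows `L_n`,
last row zero. -/
def LtP (n : ℕ) : Matrix (Fin (n + 2)) (Fin n) ℂ :=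
  fun i j => if ((i : ℕ) = 0 ∧ (j : ℕ) = 0) ∨
      (1 ≤ (i : ℕ) ∧ (i : ℕ) ≤ n ∧ ((j : ℤ) = (i : ℤ) - 2 ∨ (j : ℤ) = (i : ℤ)))
    then 1 else 0

/-- The τ₁-method inclusion set `Γ^n_ε(L_N)`. -/
noncomputable def GammaL (N n : ℕ) (ε : ℝ) : Set ℂ :=
  if n = N - 1 then pspecR (ε + epsL'' n) (LtP n)
  else pspecR (ε + epsL'' n) (LP n) ∪ pspecR (ε + epsL'' n) (LtP n)

/-- The set `[−2,2] + ε·𝔻̄ ⊆ ℂ`. -/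
def bandSet (ε : ℝ) : Set ℂ :=
  {z : ℂ | ∃ x : ℝ, x ∈ Set.Icc (-2 : ℝ) 2 ∧ ‖z - (x : ℂ)‖ ≤ ε}

end SpecInclJL

namespace SpecInclJL

section SmallestSingularValue

variable {ι κ : Type*} [Fintype ι] [Fintype κ] [DecidableEq κ]

lemma sval_le (F : Matrix ι κ ℂ) {x : EuclideanSpace ℂ κ} (hx : ‖x‖ = 1) :
    sval F ≤ ‖Matrix.toEuclideanLin F x‖ :=
  csInf_le ⟨0, by rintro _ ⟨y, -, rfl⟩; exact norm_nonneg _⟩ ⟨x, hx, rfl⟩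

lemma le_sval [Nonempty κ] {F : Matrix ι κ ℂ} {c : ℝ}
    (h : ∀ x : EuclideanSpace ℂ κ, ‖x‖ = 1 → c ≤ ‖Matrix.toEuclideanLin F x‖) :
    c ≤ sval F := by
  refine le_csInf ?_ ?_
  · obtain ⟨x, hx⟩ := exists_norm_eq (EuclideanSpace ℂ κ) zero_le_one
    exact ⟨_, x, hx, rfl⟩
  · rintro _ ⟨x, hx, rfl⟩
    exact h x hx

lemma sval_nonneg [Nonempty κ] (F : Matrix ι κ ℂ) : 0 ≤ sval F :=
  le_sval fun _ _ => norm_nonneg _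

lemma norm_sq_toEuclideanLin (F : Matrix ι κ ℂ) (x : EuclideanSpace ℂ κ) :
    ‖Matrix.toEuclideanLin F x‖ ^ 2 = ∑ i, ‖∑ j, F i j * x j‖ ^ 2 := by
  rw [EuclideanSpace.norm_sq_eq]
  rfl

lemma toEuclideanLin_sub_smul_one (A : Matrix κ κ ℂ) (z : ℂ) (x : EuclideanSpace ℂ κ) :
    Matrix.toEuclideanLin (A - z • (1 : Matrix κ κ ℂ)) x
      = Matrix.toEuclideanLin A x - z • x := by
  ext i
  simp [Matrix.toLpLin_apply]

lemma sval_sub_smul_one_le [Nonempty κ] (A : Matrix κ κ ℂ) (z w : ℂ) :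
    sval (A - z • (1 : Matrix κ κ ℂ)) ≤ sval (A - w • (1 : Matrix κ κ ℂ)) + ‖z - w‖ := by
  rw [← sub_le_iff_le_add]
  refine le_sval fun x hx => ?_
  rw [sub_le_iff_le_add]
  refine (sval_le _ hx).trans ?_
  have h : Matrix.toEuclideanLin (A - z • (1 : Matrix κ κ ℂ)) x
      = Matrix.toEuclideanLin (A - w • (1 : Matrix κ κ ℂ)) x - (z - w) • x := by
    simp only [toEuclideanLin_sub_smul_one, sub_smul]
    abel
  rw [h]
  refine (norm_sub_le _ _).trans ?_
  rw [norm_smul, hx, mul_one]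

lemma continuous_sval_sub_smul_one [Nonempty κ] (A : Matrix κ κ ℂ) :
    Continuous fun z : ℂ => sval (A - z • (1 : Matrix κ κ ℂ)) := by
  refine (LipschitzWith.of_le_add (f := fun z : ℂ => sval (A - z • (1 : Matrix κ κ ℂ)))
    fun z w => ?_).continuous
  rw [dist_eq_norm]
  exact sval_sub_smul_one_le A z w

lemma norm_sub_one_le_sval [Nonempty κ] {A : Matrix κ κ ℂ}
    (hA : ∀ x, ‖Matrix.toEuclideanLin A x‖ ≤ ‖x‖) (z : ℂ) :
    ‖z‖ - 1 ≤ sval (A - z • (1 : Matrix κ κ ℂ)) := by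
  refine le_sval fun x hx => ?_
  rw [toEuclideanLin_sub_smul_one]
  have h := norm_sub_norm_le (z • x) (Matrix.toEuclideanLin A x)
  rw [norm_smul, hx, mul_one, norm_sub_rev] at h
  have := hA x
  linarith

lemma pspec_subset_cDisc [Nonempty κ] {A : Matrix κ κ ℂ}
    (hA : ∀ x, ‖Matrix.toEuclideanLin A x‖ ≤ ‖x‖) (a : ℝ) :
    pspec a A ⊆ cDisc (1 + a) := fun z (hz : sval _ ≤ a) => by
  have := norm_sub_one_le_sval hA z
  change ‖z‖ ≤ 1 + a
  linarith

lemma pspec_mono {a b : ℝ} (hab : a ≤ b) (A : Matrix κ κ ℂ) : pspec a A ⊆ pspec b A :=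
  fun _ hz => le_trans hz hab

/-- The pseudospectra of a singular contraction grow strictly with the level. -/
lemma pspec_ssubset [Nonempty κ] {A : Matrix κ κ ℂ}
    (hA : ∀ x, ‖Matrix.toEuclideanLin A x‖ ≤ ‖x‖) (hs : sval A = 0)
    {a b : ℝ} (hb : 0 ≤ b) (hab : a < b) : pspec a A ⊂ pspec b A := by
  let f : ℝ → ℝ := fun r => sval (A - (r : ℂ) • (1 : Matrix κ κ ℂ))
  have hf : Continuous f := (continuous_sval_sub_smul_one A).comp Complex.continuous_ofReal
  have h0 : f 0 = 0 := by simp [f, hs]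
  have h1 : b ≤ f (1 + b) := by
    have h := norm_sub_one_le_sval hA ((1 + b : ℝ) : ℂ)
    rw [Complex.norm_real, Real.norm_of_nonneg (by linarith)] at h
    change b ≤ sval _
    linarith
  obtain ⟨r, -, hr⟩ := intermediate_value_Icc (by linarith : (0 : ℝ) ≤ 1 + b)
    hf.continuousOn ⟨h0.trans_le hb, h1⟩
  refine ⟨pspec_mono hab.le A, fun h => ?_⟩
  have hra : f r ≤ a := h (show f r ≤ b from hr.le)
  linarith

lemma norm_toEuclideanLin_le_of_perm {A : Matrix κ κ ℂ} (σ : Equiv.Perm κ)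
    (h : ∀ (x : EuclideanSpace ℂ κ) i, ‖∑ j, A i j * x j‖ ≤ ‖x (σ i)‖)
    (x : EuclideanSpace ℂ κ) : ‖Matrix.toEuclideanLin A x‖ ≤ ‖x‖ := by
  rw [← sq_le_sq₀ (norm_nonneg _) (norm_nonneg _), norm_sq_toEuclideanLin,
    EuclideanSpace.norm_sq_eq, ← Equiv.sum_comp σ fun i => ‖x i‖ ^ 2]
  gcongr with i
  exact h x i

end SmallestSingularValue

lemma norm_Vm_le (k : ℕ) (x : EuclideanSpace ℂ (Fin (k + 1))) :
    ‖Matrix.toEuclideanLin (Vm (k + 1)) x‖ ≤ ‖x‖ := by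
  refine norm_toEuclideanLin_le_of_perm (finRotate (k + 1)) (fun x i => ?_) x
  rw [finRotate_apply]
  have hv := Fin.val_add_one i
  by_cases hi : i = Fin.last k
  · rw [Finset.sum_eq_zero]
    · simp
    · intro j _
      have : ¬ (i : ℕ) + 1 = j := by simp [hi]; omega
      simp [Vm, this]
  · rw [if_neg hi] at hv
    simp [Vm, ← hv, ← Fin.ext_iff]

lemma norm_Vper_le (k : ℕ) {t : ℂ} (ht : ‖t‖ = 1) (x : EuclideanSpace ℂ (Fin (k + 1))) :
    ‖Matrix.toEuclideanLin (Vper (k + 1) t) x‖ ≤ ‖x‖ := by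
  refine norm_toEuclideanLin_le_of_perm (finRotate (k + 1)) (fun x i => ?_) x
  rw [finRotate_apply]
  have hv := Fin.val_add_one i
  by_cases hi : i = Fin.last k
  · rw [Fintype.sum_eq_single 0]
    · simp [Vper, hi, ht]
    · intro j hj
      have h1 : ¬ (i : ℕ) + 1 = j := by simp [hi]; omega
      have h2 : (j : ℕ) ≠ 0 := fun h => hj (Fin.ext h)
      simp [Vper, h1, h2]
  · rw [if_neg hi] at hv
    have h1 : (i : ℕ) ≠ k := fun h => hi (Fin.ext h)
    simp [Vper, ← hv, ← Fin.ext_iff, h1]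

lemma sval_Vm (k : ℕ) : sval (Vm (k + 1)) = 0 := by
  refine le_antisymm ?_ (sval_nonneg _)
  refine (sval_le _ (x := EuclideanSpace.single 0 1) (by simp)).trans_eq ?_
  rw [norm_eq_zero]
  ext i
  simp [Matrix.toLpLin_apply, Vm]

lemma pspec_Vm_ssubset {n : ℕ} (hn : 1 ≤ n) {a b : ℝ} (hb : 0 ≤ b) (hab : a < b) :
    pspec a (Vm n) ⊂ pspec b (Vm n) := by
  obtain ⟨k, rfl⟩ := Nat.exists_eq_add_of_le' hn
  exact pspec_ssubset (norm_Vm_le k) (sval_Vm k) hb hab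

lemma sval_Vm_succ_le (k : ℕ) (z : ℂ) :
    sval (Vm (k + 2) - z • (1 : Matrix (Fin (k + 2)) (Fin (k + 2)) ℂ))
      ≤ sval (Vm (k + 1) - z • (1 : Matrix (Fin (k + 1)) (Fin (k + 1)) ℂ)) := by
  refine le_sval fun x hx => ?_
  let y : EuclideanSpace ℂ (Fin (k + 2)) := WithLp.toLp 2 (Fin.snoc (α := fun _ => ℂ) x 0)
  have hyc (i : Fin (k + 1)) : y i.castSucc = x i := by simp [y]
  have hyl : y (Fin.last (k + 1)) = 0 := by simp [y]
  have hy : ‖y‖ = 1 := by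
    rw [← sq_eq_sq₀ (norm_nonneg _) zero_le_one, EuclideanSpace.norm_sq_eq,
      Fin.sum_univ_castSucc]
    simp only [hyc, hyl, norm_zero]
    rw [← hx, EuclideanSpace.norm_sq_eq]
    simp
  refine (sval_le _ hy).trans_eq ?_
  rw [← sq_eq_sq₀ (norm_nonneg _) (norm_nonneg _), norm_sq_toEuclideanLin,
    norm_sq_toEuclideanLin, Fin.sum_univ_castSucc]
  simp only [Fin.sum_univ_castSucc (n := k + 1), hyc, hyl, mul_zero, add_zero]
  have hlast : ∑ j : Fin (k + 1),
      (Vm (k + 2) - z • (1 : Matrix (Fin (k + 2)) (Fin (k + 2)) ℂ))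
        (Fin.last (k + 1)) j.castSucc * x j = 0 := by
    refine Finset.sum_eq_zero fun j _ => ?_
    have h1 : ¬ k + 1 + 1 = (j : ℕ) := by omega
    have h2 : Fin.last (k + 1) ≠ j.castSucc := (Fin.castSucc_lt_last j).ne'
    simp [Vm, h1, h2]
  rw [hlast]
  simp [Vm, Matrix.one_apply]

lemma pspec_Vm_subset_of_le (a : ℝ) {m n : ℕ} (hmn : m ≤ n) :
    pspec a (Vm (m + 1)) ⊆ pspec a (Vm (n + 1)) :=
  monotone_nat_of_le_succ (f := fun k => pspec a (Vm (k + 1)))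
    (fun k z hz => (sval_Vm_succ_le k z).trans hz) hmn

lemma VP_sub_smul_IP_apply {n : ℕ} (z : ℂ) (i j : Fin n) :
    (VP n - z • IP n) i.castSucc.succ j
      = (Vm n - z • (1 : Matrix (Fin n) (Fin n) ℂ)) i j := by
  have h : (i : ℕ) + 1 ≤ n := i.2
  simp [VP, IP, Vm, Matrix.one_apply, Fin.ext_iff, h, eq_comm]

lemma VtP_sub_smul_IP_apply {n : ℕ} (z : ℂ) (i j : Fin n) :
    (VtP n - z • IP n) i.castSucc.succ j
      = (Vm n - z • (1 : Matrix (Fin n) (Fin n) ℂ)) i j := by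
  have h : (i : ℕ) + 1 ≤ n := i.2
  simp [VtP, IP, Vm, Matrix.one_apply, Fin.ext_iff, h, eq_comm]

lemma sval_Vm_le_sval_VP (k : ℕ) (z : ℂ) :
    sval (Vm (k + 1) - z • (1 : Matrix (Fin (k + 1)) (Fin (k + 1)) ℂ))
      ≤ sval (VP (k + 1) - z • IP (k + 1)) := by
  refine le_sval fun x hx => (sval_le _ hx).trans ?_
  rw [← sq_le_sq₀ (norm_nonneg _) (norm_nonneg _), norm_sq_toEuclideanLin,
    norm_sq_toEuclideanLin, Fin.sum_univ_succ (n := k + 2),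
    Fin.sum_univ_castSucc (n := k + 1)]
  simp only [VP_sub_smul_IP_apply]
  exact (le_add_of_nonneg_right (sq_nonneg _)).trans (le_add_of_nonneg_left (sq_nonneg _))

lemma sval_VtP (n : ℕ) (z : ℂ) :
    sval (VtP n - z • IP n) = sval (Vm n - z • (1 : Matrix (Fin n) (Fin n) ℂ)) := by
  have h (x : EuclideanSpace ℂ (Fin n)) : ‖Matrix.toEuclideanLin (VtP n - z • IP n) x‖
      = ‖Matrix.toEuclideanLin (Vm n - z • (1 : Matrix (Fin n) (Fin n) ℂ)) x‖ := by
    rw [← sq_eq_sq₀ (norm_nonneg _) (norm_nonneg _), norm_sq_toEuclideanLin,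
      norm_sq_toEuclideanLin, Fin.sum_univ_succ, Fin.sum_univ_castSucc]
    simp only [VtP_sub_smul_IP_apply]
    have h0 (j : Fin n) : (VtP n - z • IP n) 0 j = 0 := by simp [VtP, IP]
    have h1 (j : Fin n) : (VtP n - z • IP n) (Fin.last n).succ j = 0 := by
      have : n ≠ (j : ℕ) := j.2.ne'
      simp [VtP, IP, this]
    simp only [h0, h1, zero_mul, Finset.sum_const_zero, norm_zero, ne_eq, OfNat.ofNat_ne_zero,
      not_false_eq_true, zero_pow, zero_add, add_zero]
  simp only [sval, h]

lemma GammaV_eq {n : ℕ} (hn : 1 ≤ n) (ε : ℝ) : GammaV n ε = pspec (ε + epsV'' n) (Vm n) := by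
  obtain ⟨k, rfl⟩ := Nat.exists_eq_add_of_le' hn
  have h : pspecR (ε + epsV'' (k + 1)) (VtP (k + 1))
      = pspec (ε + epsV'' (k + 1)) (Vm (k + 1)) := by
    simp only [pspecR, pspec, sval_VtP]
  rw [GammaV, h]
  exact Set.union_eq_right.2 fun z hz => (sval_Vm_le_sval_VP k z).trans hz

lemma SigmaV_subset {n : ℕ} (ε : ℝ) : SigmaV n ε ⊆ pspec (ε + epsV n) (Vm n) := by
  have h : ⋃ m : Fin n, pspec (ε + epsV n) (Vm (m + 1)) ⊆ pspec (ε + epsV n) (Vm n) := by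
    refine Set.iUnion_subset fun m => ?_
    obtain ⟨k, rfl⟩ := Nat.exists_eq_add_of_le' (Nat.one_le_of_lt m.2)
    exact pspec_Vm_subset_of_le _ (Nat.le_of_lt_succ m.2)
  rw [SigmaV]
  split_ifs
  · exact h
  · exact Set.inter_subset_right.trans h

lemma sin_pi_div_lt_sin_pi_div {a b : ℝ} (ha : 2 ≤ a) (hab : a < b) :
    Real.sin (π / b) < Real.sin (π / a) := by
  have hπ := Real.pi_pos
  have hb : 0 < π / b := div_pos hπ (by linarith)
  refine Real.sin_lt_sin_of_lt_of_le_pi_div_two (by linarith) ?_ ?_ <;> gcongr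

lemma epsV_lt_epsV'' {n : ℕ} (hn : 1 ≤ n) : epsV n < epsV'' n := by
  have h : (1 : ℝ) ≤ n := by exact_mod_cast hn
  exact mul_lt_mul_of_pos_left (sin_pi_div_lt_sin_pi_div (by linarith) (by linarith)) two_pos

lemma epsV''_lt_epsV' {n : ℕ} (hn : 1 ≤ n) : epsV'' n < epsV' n := by
  have h : (1 : ℝ) ≤ n := by exact_mod_cast hn
  exact mul_lt_mul_of_pos_left (sin_pi_div_lt_sin_pi_div (by linarith) (by linarith)) two_pos

lemma epsV''_nonneg (n : ℕ) : 0 ≤ epsV'' n := by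
  have h : (0 : ℝ) ≤ n := n.cast_nonneg
  refine mul_nonneg zero_le_two (Real.sin_nonneg_of_nonneg_of_le_pi (by positivity) ?_)
  exact div_le_self Real.pi_pos.le (by linarith)

end SpecInclJL

open SpecInclJL in
/-- **Proposition 5.1 (comparison of the τ, τ₁ and π inclusion sets for the
Jordan block).** For every `N > 1`, `n ∈ {1,…,N−1}`, ε ≥ 0 and `t ∈ 𝕋`:
`Γ^n_ε(V_N) = Spec_{ε+ε''_n} V_n` and
`Σ^n_ε(V_N) ⊊ Γ^n_ε(V_N) ⊊ Π^{n,t}_ε(V_N) ⊆ (1+ε+ε'_n)𝔻̄`. -/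
theorem jordan_methods_comparison (N : ℕ) (hN : 1 < N)
    (n : ℕ) (hn : 1 ≤ n) (hnN : n ≤ N - 1) (ε : ℝ) (hε : 0 ≤ ε)
    (t : ℂ) (ht : ‖t‖ = 1) :
    GammaV n ε = pspec (ε + epsV'' n) (Vm n) ∧
    SigmaV n ε ⊂ GammaV n ε ∧
    GammaV n ε ⊂ PiV n t ε ∧
    PiV n t ε ⊆ cDisc (1 + ε + epsV' n) := by
  have hlt := epsV''_lt_epsV' hn
  have h0 := epsV''_nonneg n
  rw [GammaV_eq hn]
  refine ⟨rfl, ?_, ?_, ?_⟩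
  · exact (SigmaV_subset ε).trans_ssubset (pspec_Vm_ssubset hn (by linarith)
      (by linarith [epsV_lt_epsV'' hn]))
  · exact (pspec_Vm_ssubset hn (by linarith) (by linarith)).trans_subset
      Set.subset_union_left
  · obtain ⟨k, rfl⟩ := Nat.exists_eq_add_of_le' hn
    rw [add_assoc]
    exact Set.union_subset (pspec_subset_cDisc (norm_Vm_le k) _)
      (pspec_subset_cDisc (norm_Vper_le k ht) _)
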